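/- arXiv:1801.07006 — 8 statements merged into one kernel-verified Lean document; each statement's English description precedes it below -/
import Mathlib

section
/- Let γ ∈ (0,1) be a real number and h a positive integer. Then the real-valued sequence i ↦ C(h + ⌊γ·i + 1/2⌋, h) / C(h + i, h) − γ^h is O(1/i) as i → ∞; that is, the function i ↦ C(h + ⌊γ·i + 1/2⌋, h) / C(h + i, h) − γ^h is big-O of i ↦ 1/i along the filter at infinity on ℕ. -/
open Filter Asymptotics

theorem isBigO_add_div_add_sub {γ : ℝ} {m : ℕ → ℕ}
    (hm : (fun i : ℕ => (m i : ℝ) - γ * i) =O[atTop] (fun _ => (1 : ℝ))) (c : ℝ) (hc : 0 < c) :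
    (fun i : ℕ => (c + m i) / (c + i) - γ) =O[atTop] (fun i : ℕ => (1 : ℝ) / i) := by
  have hnum : (fun i : ℕ => ((m i : ℝ) - γ * i) + c * (1 - γ)) =O[atTop] (fun _ => (1 : ℝ)) :=
    hm.add (isBigO_const_const _ one_ne_zero _)
  have hden : (fun i : ℕ => (1 : ℝ) / (c + i)) =O[atTop] (fun i : ℕ => (1 : ℝ) / i) := by
    refine IsBigO.of_bound 1 ?_
    filter_upwards [eventually_gt_atTop 0] with i hi
    have hi' : (0 : ℝ) < i := Nat.cast_pos.mpr hi
    rw [one_mul, Real.norm_of_nonneg (by positivity), Real.norm_of_nonneg (by positivity)]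
    exact one_div_le_one_div_of_le hi' (by linarith)
  refine (hnum.mul hden).congr (fun i => ?_) (fun i => one_mul _)
  have : c + (i : ℝ) ≠ 0 := by positivity
  field_simp
  ring

theorem isBigO_choose_div_choose_sub_pow {γ : ℝ} {m : ℕ → ℕ}
    (hm : (fun i : ℕ => (m i : ℝ) - γ * i) =O[atTop] (fun _ => (1 : ℝ))) (h : ℕ) :
    (fun i : ℕ => (Nat.choose (h + m i) h : ℝ) / (Nat.choose (h + i) h : ℝ) - γ ^ h)
      =O[atTop] (fun i : ℕ => (1 : ℝ) / i) := by
  induction h with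
  | zero => simpa using isBigO_zero _ _
  | succ h ih =>
    have hq := isBigO_add_div_add_sub hm ((h : ℝ) + 1) (by positivity)
    have hone : (fun i : ℕ => (1 : ℝ) / i) =O[atTop] (fun _ => (1 : ℝ)) :=
      tendsto_one_div_atTop_nhds_zero_nat.isBigO_one ℝ
    have hbdd : (fun i : ℕ => ((h : ℝ) + 1 + m i) / ((h : ℝ) + 1 + i)) =O[atTop]
        (fun _ => (1 : ℝ)) :=
      ((hq.trans hone).add (isBigO_const_const γ one_ne_zero _)).congr_left (fun i => by ring)
    have hchoose (n : ℕ) : (Nat.choose (h + 1 + n) (h + 1) : ℝ)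
        = (h + 1 + n) * Nat.choose (h + n) h / (h + 1) := by
      rw [eq_div_iff (by positivity), show h + 1 + n = h + n + 1 by ring]
      have := Nat.add_one_mul_choose_eq (h + n) h
      have : ((h + n + 1 : ℕ) : ℝ) * Nat.choose (h + n) h
          = Nat.choose (h + n + 1) (h + 1) * ((h + 1 : ℕ) : ℝ) := mod_cast this
      rw [Nat.cast_add_one, Nat.cast_add, Nat.cast_add_one] at this
      rw [← this]
      ring
    have hprod := (ih.mul hbdd).congr_right (fun i => mul_one _)
    refine (hprod.add (hq.const_mul_left (γ ^ h))).congr_left (fun i => ?_)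
    have hpos : (Nat.choose (h + i) h : ℝ) ≠ 0 :=
      Nat.cast_ne_zero.mpr (Nat.choose_pos (Nat.le_add_right h i)).ne'
    have hi : (h : ℝ) + 1 + i ≠ 0 := by positivity
    rw [hchoose, hchoose]
    field_simp
    ring

theorem isBigO_toNat_floor_add_half_sub {γ : ℝ} (hγ : 0 ≤ γ) :
    (fun i : ℕ => ((⌊γ * i + 1 / 2⌋.toNat : ℕ) : ℝ) - γ * i) =O[atTop] (fun _ => (1 : ℝ)) := by
  refine IsBigO.of_bound 1 (Eventually.of_forall fun i => ?_)
  have hnonneg : 0 ≤ ⌊γ * i + 1 / 2⌋ := Int.floor_nonneg.mpr (by positivity)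
  have hcast : ((⌊γ * i + 1 / 2⌋.toNat : ℕ) : ℝ) = (⌊γ * i + 1 / 2⌋ : ℝ) :=
    mod_cast congrArg (Int.cast (R := ℝ)) (Int.toNat_of_nonneg hnonneg)
  have hle := Int.floor_le (γ * i + 1 / 2)
  have hlt := Int.lt_floor_add_one (γ * i + 1 / 2)
  rw [hcast, norm_one, mul_one, Real.norm_eq_abs, abs_le]
  constructor <;> linarith

/-- For fixed `γ ∈ (0,1)` and positive integer `h`, the sequence
`i ↦ C(h + ⌊γ·i + 1/2⌋, h) / C(h + i, h) − γ^h` is `O(1/i)` as `i → ∞`. -/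
theorem binomial_ratio_convergence (γ : ℝ) (hγ0 : 0 < γ) (hγ1 : γ < 1) (h : ℕ) (hh : 0 < h) :
    (fun i : ℕ =>
        (Nat.choose (h + (⌊γ * i + 1 / 2⌋).toNat) h : ℝ) / (Nat.choose (h + i) h : ℝ) - γ ^ h)
      =O[atTop] (fun i : ℕ => (1 : ℝ) / i) := by
  exact isBigO_choose_div_choose_sub_pow (isBigO_toNat_floor_add_half_sub hγ0.le) h
end

section
/- Fix positive integers h, m, n with m < n, and let γ = (m/n)^{1/(h+1)} ∈ (0,1). For positive integers ℓ ≥ s ≥ 1, define the real number t_new(ℓ, s) = n·(1 − (s·C(h+s−1, h) − h·C(h+s−1, h+1)) / (s·C(h+ℓ, h))) − (h/(h+1))·(ℓ/s)·m + (1/s)·(1/C(h+ℓ, h) − 1). Set ℓ_i = i and s_i = ⌊γ·i + 1/2⌋ + 1 for i ∈ ℕ. Then the sequence i ↦ t_new(ℓ_i, s_i) − n·(1 − (m/n)^{h/(h+1)}) is O(1/i) as i → ∞. -/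
open Filter Asymptotics

/-- A closed form of the multiplicity term of the decoding radius. -/
theorem decoding_ratio_eq_choose_div (h ℓ s : ℕ) (hs : 1 ≤ s) :
    ((s : ℝ) * (Nat.choose (h + s - 1) h : ℝ) - (h : ℝ) * (Nat.choose (h + s - 1) (h + 1) : ℝ))
        / ((s : ℝ) * (Nat.choose (h + ℓ) h : ℝ))
      = 1 / ((h : ℝ) + 1) * ((Nat.choose (h + s) h : ℝ) / (Nat.choose (h + ℓ) h : ℝ)) := by
  obtain ⟨t, rfl⟩ : ∃ t, s = t + 1 := ⟨s - 1, by omega⟩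
  have e1 := Nat.choose_succ_right_eq (h + t) h
  have e2 := Nat.choose_mul_succ_eq (h + t) h
  rw [show h + t - h = t by omega] at e1
  rw [show h + t + 1 - h = t + 1 by omega] at e2
  rw [show h + (t + 1) - 1 = h + t by omega, show h + (t + 1) = h + t + 1 by omega]
  have e1' : ((h + t).choose (h + 1) : ℝ) * (h + 1) = (h + t).choose h * t := by
    exact_mod_cast e1
  have e2' : ((h + t).choose h : ℝ) * (h + t + 1) = (h + t + 1).choose h * (t + 1) := by
    exact_mod_cast e2
  have hC : ((h + ℓ).choose h : ℝ) ≠ 0 := by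
    exact_mod_cast (Nat.choose_pos (Nat.le_add_right h ℓ)).ne'
  have ht : (t : ℝ) + 1 ≠ 0 := by positivity
  push_cast
  field_simp
  linear_combination e2' - h * e1'

theorem choose_div_choose_eq_prod (h ℓ s : ℕ) :
    (Nat.choose (h + s) h : ℝ) / (Nat.choose (h + ℓ) h : ℝ)
      = ∏ j ∈ Finset.range h, ((s : ℝ) + 1 + j) / ((ℓ : ℝ) + 1 + j) := by
  have key : ∀ k : ℕ, ∏ j ∈ Finset.range h, ((k : ℝ) + 1 + j)
      = (h.factorial : ℝ) * (Nat.choose (h + k) h : ℝ) := by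
    intro k
    have e := Nat.ascFactorial_eq_factorial_mul_choose k h
    rw [Nat.ascFactorial_eq_prod_range, add_comm k h] at e
    exact_mod_cast e
  rw [Finset.prod_div_distrib, key, key, mul_div_mul_left]
  exact_mod_cast h.factorial_ne_zero

theorem isBigO_mul_sub_mul {u v g : ℕ → ℝ} {a b : ℝ} (hg : g =O[atTop] (fun _ => (1 : ℝ)))
    (hu : (fun i => u i - a) =O[atTop] g) (hv : (fun i => v i - b) =O[atTop] g) :
    (fun i => u i * v i - a * b) =O[atTop] g := by
  have hv1 : v =O[atTop] (fun _ => (1 : ℝ)) := by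
    simpa using (hv.trans hg).add (isBigO_const_const b one_ne_zero atTop)
  have h1 : (fun i => (u i - a) * v i) =O[atTop] g := by simpa using hu.mul hv1
  refine (h1.add (hv.const_mul_left a)).congr_left fun i => ?_
  ring

theorem isBigO_prod_sub_pow {u : ℕ → ℕ → ℝ} {g : ℕ → ℝ} {a : ℝ}
    (hg : g =O[atTop] (fun _ => (1 : ℝ)))
    (hu : ∀ j, (fun i => u j i - a) =O[atTop] g) (k : ℕ) :
    (fun i => ∏ j ∈ Finset.range k, u j i - a ^ k) =O[atTop] g := by
  induction k with
  | zero => simpa using isBigO_zero g atTop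
  | succ k ih =>
    simp only [Finset.prod_range_succ, pow_succ]
    exact isBigO_mul_sub_mul hg ih (hu k)

/-- Asymptotic decoding radius: with `γ = (m/n)^(1/(h+1))`, `ℓᵢ = i`, `sᵢ = ⌊γ·i⌉ + 1`,
the decoding radius `t_new(ℓᵢ, sᵢ)` satisfies
`t_new(ℓᵢ, sᵢ) = n·(1 − (m/n)^(h/(h+1))) + O(1/i)` as `i → ∞`. -/
theorem asymptotic_decoding_radius (h m n : ℕ) (hh : 0 < h) (hm : 0 < m) (hn : 0 < n)
    (hmn : m < n) (γ : ℝ) (hγ : γ = ((m : ℝ) / n) ^ ((1 : ℝ) / (h + 1)))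
    (tnew : ℕ → ℕ → ℝ)
    (htnew : ∀ ℓ s : ℕ, 1 ≤ s → s ≤ ℓ →
      tnew ℓ s =
        (n : ℝ) * (1 -
            ((s : ℝ) * (Nat.choose (h + s - 1) h : ℝ) - (h : ℝ) * (Nat.choose (h + s - 1) (h + 1) : ℝ))
              / ((s : ℝ) * (Nat.choose (h + ℓ) h : ℝ)))
          - ((h : ℝ) / ((h : ℝ) + 1)) * ((ℓ : ℝ) / (s : ℝ)) * (m : ℝ)
          + (1 / (s : ℝ)) * (1 / (Nat.choose (h + ℓ) h : ℝ) - 1))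
    (s : ℕ → ℕ) (hs : ∀ i : ℕ, s i = (⌊γ * i + 1 / 2⌋).toNat + 1) :
    (fun i : ℕ => tnew i (s i) - (n : ℝ) * (1 - ((m : ℝ) / n) ^ ((h : ℝ) / ((h : ℝ) + 1))))
      =O[atTop] (fun i : ℕ => (1 : ℝ) / i) := by
  have hmR : (0 : ℝ) < m := by exact_mod_cast hm
  have hnR : (0 : ℝ) < n := by exact_mod_cast hn
  have hq0 : (0 : ℝ) < (m : ℝ) / n := by positivity
  have hq1 : (m : ℝ) / n < 1 := by
    rw [div_lt_one hnR]
    exact_mod_cast hmn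
  have hγ0 : 0 < γ := hγ ▸ Real.rpow_pos_of_pos hq0 _
  have hγ1 : γ < 1 := hγ ▸ Real.rpow_lt_one hq0.le hq1 (by positivity)
  have hγh : ((m : ℝ) / n) ^ ((h : ℝ) / ((h : ℝ) + 1)) = γ ^ h := by
    rw [hγ, ← Real.rpow_natCast, ← Real.rpow_mul hq0.le]
    congr 1
    ring
  have hγm : (m : ℝ) = n * γ ^ (h + 1) := by
    have : γ ^ (h + 1) = (m : ℝ) / n := by
      rw [hγ, ← Real.rpow_natCast, ← Real.rpow_mul hq0.le]
      push_cast
      rw [one_div_mul_cancel (by positivity), Real.rpow_one]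
    rw [this]
    field_simp
  have hs_cast : ∀ i, (s i : ℝ) = ⌊γ * i + 1 / 2⌋ + 1 := by
    intro i
    have h0 : 0 ≤ ⌊γ * i + 1 / 2⌋ := Int.floor_nonneg.2 (by positivity)
    rw [hs]
    push_cast
    congr 1
    exact_mod_cast Int.toNat_of_nonneg h0
  have hs_lo : ∀ i, γ * i ≤ s i := fun i => by
    have := Int.lt_floor_add_one (γ * i + 1 / 2)
    rw [hs_cast]
    linarith
  have hs_hi : ∀ i, (s i : ℝ) ≤ γ * i + 2 := fun i => by
    have := Int.floor_le (γ * i + 1 / 2)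
    rw [hs_cast]
    linarith
  have hs_pos : ∀ i, 1 ≤ s i := fun i => by rw [hs]; omega
  have hs_le : ∀ᶠ i : ℕ in atTop, s i ≤ i := by
    filter_upwards [eventually_ge_atTop ⌈2 / (1 - γ)⌉₊] with i hi
    have h1 : 2 / (1 - γ) ≤ i := Nat.ceil_le.1 hi
    rw [div_le_iff₀ (by linarith)] at h1
    have h2 := hs_hi i
    exact_mod_cast (by linarith : (s i : ℝ) ≤ i)
  have hg : (fun i : ℕ => (1 : ℝ) / i) =O[atTop] (fun _ => (1 : ℝ)) :=
    tendsto_one_div_atTop_nhds_zero_nat.isBigO_one ℝ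
  have hfac : ∀ j : ℕ, (fun i : ℕ => ((s i : ℝ) + 1 + j) / ((i : ℝ) + 1 + j) - γ)
      =O[atTop] (fun i : ℕ => (1 : ℝ) / i) := by
    intro j
    refine IsBigO.of_bound (3 + j) ?_
    filter_upwards [eventually_gt_atTop 0] with i hi
    have hiR : (0 : ℝ) < i := by exact_mod_cast hi
    have e : ((s i : ℝ) + 1 + j) / ((i : ℝ) + 1 + j) - γ
        = (s i - γ * i + (1 - γ) * (1 + j)) / ((i : ℝ) + 1 + j) := by
      field_simp
      ring
    have hb : 0 ≤ (s i : ℝ) - γ * i + (1 - γ) * (1 + j) := by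
      have : 0 ≤ (1 - γ) * (1 + (j : ℝ)) := mul_nonneg (by linarith) (by positivity)
      linarith [hs_lo i]
    rw [e, Real.norm_of_nonneg (div_nonneg hb (by positivity)),
      Real.norm_of_nonneg (by positivity), mul_one_div]
    refine div_le_div₀ (by positivity) ?_ hiR (by linarith [(j.cast_nonneg : (0 : ℝ) ≤ j)])
    have : 0 ≤ γ * (1 + (j : ℝ)) := by positivity
    linarith [hs_hi i]
  have hratio : (fun i : ℕ => (i : ℝ) / s i - 1 / γ) =O[atTop] (fun i : ℕ => (1 : ℝ) / i) := by
    refine IsBigO.of_bound (2 / γ ^ 2) ?_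
    filter_upwards [eventually_gt_atTop 0] with i hi
    have hiR : (0 : ℝ) < i := by exact_mod_cast hi
    have hsR : (0 : ℝ) < s i := by exact_mod_cast hs_pos i
    have e : (i : ℝ) / s i - 1 / γ = -((s i - γ * i) / (γ * s i)) := by
      field_simp
      ring
    rw [e, norm_neg, Real.norm_of_nonneg (div_nonneg (by linarith [hs_lo i]) (by positivity)),
      Real.norm_of_nonneg (by positivity), div_mul_div_comm, mul_one]
    refine div_le_div₀ (by positivity) (by linarith [hs_hi i]) (by positivity) ?_
    rw [pow_two, mul_assoc]
    exact mul_le_mul_of_nonneg_left (hs_lo i) hγ0.le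
  have htail : (fun i : ℕ => (1 / (s i : ℝ)) * (1 / (Nat.choose (h + i) h : ℝ) - 1))
      =O[atTop] (fun i : ℕ => (1 : ℝ) / i) := by
    refine IsBigO.of_bound (1 / γ) ?_
    filter_upwards [eventually_gt_atTop 0] with i hi
    have hiR : (0 : ℝ) < i := by exact_mod_cast hi
    have hC : (1 : ℝ) ≤ (h + i).choose h := by
      exact_mod_cast Nat.choose_pos (Nat.le_add_right h i)
    have hC1 : 1 / ((h + i).choose h : ℝ) ≤ 1 := by
      rw [div_le_one (by linarith)]
      exact hC
    have hC0 : 0 ≤ 1 / ((h + i).choose h : ℝ) := by positivity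
    rw [norm_mul, Real.norm_of_nonneg (by positivity : 0 ≤ 1 / (s i : ℝ)),
      Real.norm_of_nonneg (by positivity : 0 ≤ 1 / (i : ℝ))]
    calc 1 / (s i : ℝ) * ‖1 / ((h + i).choose h : ℝ) - 1‖
        ≤ 1 / (s i : ℝ) * 1 := by
          refine mul_le_mul_of_nonneg_left ?_ (by positivity)
          rw [Real.norm_eq_abs, abs_le]
          constructor <;> linarith
      _ ≤ 1 / (γ * i) := by
          rw [mul_one]
          exact one_div_le_one_div_of_le (by positivity) (hs_lo i)
      _ = 1 / γ * (1 / i) := by rw [one_div_mul_one_div]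
  have hmain := (((isBigO_prod_sub_pow hg hfac h).const_mul_left (-(n / ((h : ℝ) + 1)))).add
    (hratio.const_mul_left (-((h : ℝ) / (h + 1) * m)))).add htail
  refine hmain.congr' ?_ EventuallyEq.rfl
  filter_upwards [hs_le] with i hi
  rw [htnew i (s i) (hs_pos i) hi, decoding_ratio_eq_choose_div h i (s i) (hs_pos i),
    choose_div_choose_eq_prod, hγh]
  have hlim : (h : ℝ) / (h + 1) * m * (1 / γ) = (h : ℝ) / (h + 1) * (n * γ ^ h) := by
    rw [hγm, pow_succ]
    field_simp
  have hsum : 1 / ((h : ℝ) + 1) + h / (h + 1) = 1 := by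
    field_simp
    ring
  linear_combination hlim + n * γ ^ h * hsum
end

section
/- Let p be a prime, e ≥ 1, q = p^e, and let F be a finite field with q² elements. Then the number of pairs (x, y) ∈ F × F satisfying y^q + y = x^{q+1} is exactly q³. -/
open Polynomial in
/-- A polynomial of the form `X ^ n + c X` with `n ≥ 2` has at most `n` roots. -/
theorem ncard_pow_add_mul_eq_zero_le {F : Type*} [Field F] {n : ℕ} (hn : 2 ≤ n) (c : F) :
    {y : F | y ^ n + c * y = 0}.ncard ≤ n := by
  classical
  have hdeg : (C c * X : F[X]).degree < (X ^ n : F[X]).degree := by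
    rw [degree_X_pow]
    exact (degree_C_mul_X_le c).trans_lt (by exact_mod_cast hn)
  have hnat : (X ^ n + C c * X : F[X]).natDegree = n := by
    rw [natDegree_add_eq_left_of_degree_lt hdeg, natDegree_X_pow]
  have h0 : (X ^ n + C c * X : F[X]) ≠ 0 := by
    intro h
    rw [h, natDegree_zero] at hnat
    omega
  have hset : {y : F | y ^ n + c * y = 0} = (X ^ n + C c * X : F[X]).rootSet F := by
    ext y
    simp [mem_rootSet, h0]
  rw [hset]
  exact (ncard_rootSet_le _ F).trans_eq hnat

/-- The Hermitian curve `Y^q + Y = X^(q+1)` has exactly `q³` affine rational points over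
the field with `q²` elements. -/
theorem hermitian_curve_point_count (p e q : ℕ) (hp : p.Prime) (he : 1 ≤ e) (hq : q = p ^ e)
    (F : Type*) [Field F] [Fintype F] (hF : Fintype.card F = q ^ 2) :
    Nat.card {xy : F × F // xy.2 ^ q + xy.2 = xy.1 ^ (q + 1)} = q ^ 3 := by
  have : Fact p.Prime := ⟨hp⟩
  have hq2 : 2 ≤ q := hq ▸ hp.two_le.trans (Nat.le_self_pow (by omega) p)
  have : CharP F p := charP_of_card_eq_prime_pow (f := e * 2) (by rw [hF, hq, pow_mul])
  have hadd (a b : F) : (a + b) ^ q = a ^ q + b ^ q := by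
    rw [hq, add_pow_char_pow]
  have hfrob (a : F) : (a ^ q) ^ q = a := by
    rw [← pow_mul, ← sq, ← hF, FiniteField.pow_card]
  let T : F →+ F := AddMonoidHom.mk' (fun y ↦ y ^ q + y) fun a b ↦ by rw [hadd]; ring
  have hT (y : F) : T y = y ^ q + y := rfl
  let K : Set F := {a | a ^ q + (-1) * a = 0}
  have hK (a : F) : a ∈ K ↔ a ^ q = a := by
    simp only [K, Set.mem_ofPred_eq, neg_one_mul, ← sub_eq_add_neg, sub_eq_zero]
  have hKcard : K.ncard ≤ q := ncard_pow_add_mul_eq_zero_le hq2 (-1)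
  have hsub : (T.range : Set F) ⊆ K := by
    rintro _ ⟨y, rfl⟩
    rw [hK, hT, hadd, hfrob, add_comm]
  have hker : Nat.card T.ker ≤ q := by
    have h := ncard_pow_add_mul_eq_zero_le hq2 (1 : F)
    simp only [one_mul] at h
    exact h
  have hrange : Nat.card T.range ≤ q := (Set.ncard_le_ncard hsub).trans hKcard
  have hmul : Nat.card T.ker * Nat.card T.range = q ^ 2 := by
    rw [← AddSubgroup.index_ker, AddSubgroup.card_mul_index, Nat.card_eq_fintype_card, hF]
  have hker_eq : Nat.card T.ker = q := by nlinarith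
  have hrange_eq : Nat.card T.range = q := by nlinarith
  have hrange_K : (T.range : Set F) = K :=
    Set.eq_of_subset_of_ncard_le hsub (hKcard.trans_eq hrange_eq.symm)
  have hfiber (x : F) : Nat.card {y : F // y ^ q + y = x ^ (q + 1)} = q := by
    obtain ⟨z, hz⟩ : x ^ (q + 1) ∈ (T.range : Set F) := by
      rw [hrange_K, hK, pow_succ, mul_pow, hfrob, mul_comm]
    rw [← hz]
    exact (Nat.card_congr (T.fiberEquivKer z)).trans hker_eq
  let E : {xy : F × F // xy.2 ^ q + xy.2 = xy.1 ^ (q + 1)} ≃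
      Σ x : F, {y : F // y ^ q + y = x ^ (q + 1)} :=
    Equiv.subtypeProdEquivSigmaSubtype fun x y : F ↦ y ^ q + y = x ^ (q + 1)
  rw [Nat.card_congr E, Nat.card_sigma]
  simp only [hfiber, Finset.sum_const, Finset.card_univ, hF, smul_eq_mul]
  ring
end

section
/- Let p be a prime, e ≥ 1, q = p^e, let F be a finite field with q² elements, and let S = {(x, y) ∈ F × F : y^q + y = x^{q+1}}. For every function r : S → F there exists a polynomial R ∈ F[X, Y] whose degree in Y is less than q, such that every monomial X^i Y^j occurring in R satisfies q·i + (q+1)·j < q³ + q² − q, and such that R(x, y) = r(x, y) for all (x, y) ∈ S. -/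
/-- Substituting the variable `X i` into a univariate polynomial `P` gives a multivariate
polynomial whose degree in any variable is at most the degree of `P`. -/
theorem MvPolynomial.degreeOf_aeval_X_le {σ R : Type*} [CommSemiring R] [Nontrivial R]
    (i k : σ) (P : Polynomial R) :
    (Polynomial.aeval (MvPolynomial.X i : MvPolynomial σ R) P).degreeOf k ≤ P.natDegree := by
  classical
  rw [Polynomial.aeval_eq_sum_range]
  refine (MvPolynomial.degreeOf_sum_le _ _ _).trans (Finset.sup_le fun n hn => ?_)
  rw [MvPolynomial.smul_eq_C_mul]
  refine (MvPolynomial.degreeOf_C_mul_le _ _ _).trans ?_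
  refine (MvPolynomial.degreeOf_pow_le _ _ _).trans ?_
  have hX : (MvPolynomial.X i : MvPolynomial σ R).degreeOf k ≤ 1 := by
    rw [MvPolynomial.degreeOf_X]
    split_ifs <;> omega
  calc n * (MvPolynomial.X i : MvPolynomial σ R).degreeOf k ≤ n * 1 := by gcongr
    _ ≤ P.natDegree := by simpa [Nat.lt_succ_iff] using hn

theorem MvPolynomial.degreeOf_aeval_X_of_ne {σ R : Type*} [CommSemiring R] [Nontrivial R]
    {i k : σ} (h : k ≠ i) (P : Polynomial R) :
    (Polynomial.aeval (MvPolynomial.X i : MvPolynomial σ R) P).degreeOf k = 0 := by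
  classical
  rw [Polynomial.aeval_eq_sum_range, ← Nat.le_zero]
  refine (MvPolynomial.degreeOf_sum_le _ _ _).trans (Finset.sup_le fun n hn => ?_)
  rw [MvPolynomial.smul_eq_C_mul]
  refine (MvPolynomial.degreeOf_C_mul_le _ _ _).trans ?_
  refine (MvPolynomial.degreeOf_pow_le _ _ _).trans ?_
  simp [MvPolynomial.degreeOf_X, h]

theorem MvPolynomial.eval_aeval_X {σ R : Type*} [CommSemiring R] (i : σ) (v : σ → R)
    (P : Polynomial R) :
    MvPolynomial.eval v (Polynomial.aeval (MvPolynomial.X i : MvPolynomial σ R) P) =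
      P.eval (v i) := by
  rw [Polynomial.aeval_eq_sum_range, map_sum, Polynomial.eval_eq_sum_range]
  simp [MvPolynomial.smul_eval]

/-- The equation `y ^ q + y = c` has at most `q` solutions in a domain. -/
theorem card_filter_pow_add_self_le {F : Type*} [CommRing F] [IsDomain F] [Fintype F]
    [DecidableEq F] {q : ℕ} (hq : 1 < q) (c : F) :
    (Finset.univ.filter fun y : F => y ^ q + y = c).card ≤ q := by
  have hdeg : (Polynomial.X ^ q + (Polynomial.X - Polynomial.C c) : Polynomial F).natDegree =
      q := by
    rw [Polynomial.natDegree_add_eq_left_of_natDegree_lt] <;>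
      simp [hq]
  have h0 : (Polynomial.X ^ q + (Polynomial.X - Polynomial.C c) : Polynomial F) ≠ 0 := by
    intro h
    rw [h, Polynomial.natDegree_zero] at hdeg
    omega
  refine (Polynomial.card_le_degree_of_subset_roots fun y hy => ?_).trans_eq hdeg
  rw [Finset.mem_val, Finset.mem_filter] at hy
  rw [Polynomial.mem_roots h0, Polynomial.IsRoot.def]
  simp only [Polynomial.eval_add, Polynomial.eval_sub, Polynomial.eval_pow, Polynomial.eval_X,
    Polynomial.eval_C]
  linear_combination hy.2

/-- A finite union of vertical fibres `T a`, each with at most `m` points, can be interpolated by a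
polynomial of degree less than `Fintype.card F` in the first variable and less than `m` in the
second. -/
theorem exists_interpolation_of_card_fibre_le {F : Type*} [Field F] [Fintype F]
    {m : ℕ} (hm : 0 < m) (T : F → Finset F) (hT : ∀ a, (T a).card ≤ m) (f : F → F → F) :
    ∃ R : MvPolynomial (Fin 2) F,
      R.degreeOf 0 < Fintype.card F ∧ R.degreeOf 1 < m ∧
      ∀ a, ∀ b ∈ T a, MvPolynomial.eval ![a, b] R = f a b := by
  classical
  have hinj (s : Finset F) : Set.InjOn (id : F → F) s := Function.injective_id.injOn
  have hcard : 0 < Fintype.card F := Fintype.card_pos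
  have hnat {P : Polynomial F} {k n : ℕ} (hP : P.degree < k) (hkn : k ≤ n) (hn : 0 < n) :
      P.natDegree < n := by
    by_cases h0 : P = 0
    · simpa [h0] using hn
    · exact ((Polynomial.natDegree_lt_iff_degree_lt h0).2 hP).trans_le hkn
  set B : F → Polynomial F := fun a => Lagrange.interpolate Finset.univ id (Pi.single a 1)
  set L : F → Polynomial F := fun a => Lagrange.interpolate (T a) id (f a)
  have hB (a : F) : (B a).natDegree < Fintype.card F :=
    hnat (Lagrange.degree_interpolate_lt _ (hinj _)) le_rfl hcard
  have hL (a : F) : (L a).natDegree < m :=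
    hnat (Lagrange.degree_interpolate_lt _ (hinj _)) (hT a) hm
  refine ⟨∑ a, Polynomial.aeval (MvPolynomial.X 0) (B a) *
    Polynomial.aeval (MvPolynomial.X 1) (L a), ?_, ?_, fun x y hy => ?_⟩
  · refine (MvPolynomial.degreeOf_sum_le _ _ _).trans_lt
      ((Finset.sup_lt_iff hcard).2 fun a _ => ?_)
    refine (MvPolynomial.degreeOf_mul_le _ _ _).trans_lt ?_
    rw [MvPolynomial.degreeOf_aeval_X_of_ne (by decide : (0 : Fin 2) ≠ 1), add_zero]
    exact (MvPolynomial.degreeOf_aeval_X_le _ _ _).trans_lt (hB a)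
  · refine (MvPolynomial.degreeOf_sum_le _ _ _).trans_lt
      ((Finset.sup_lt_iff hm).2 fun a _ => ?_)
    refine (MvPolynomial.degreeOf_mul_le _ _ _).trans_lt ?_
    rw [MvPolynomial.degreeOf_aeval_X_of_ne (by decide : (1 : Fin 2) ≠ 0), zero_add]
    exact (MvPolynomial.degreeOf_aeval_X_le _ _ _).trans_lt (hL a)
  · have hBx (a : F) : (B a).eval x = (Pi.single a 1 : F → F) x :=
      Lagrange.eval_interpolate_at_node _ (hinj _) (Finset.mem_univ x)
    have hLy : (L x).eval y = f x y :=
      Lagrange.eval_interpolate_at_node _ (hinj _) hy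
    simp only [map_sum, map_mul, MvPolynomial.eval_aeval_X, Matrix.cons_val_zero,
      Matrix.cons_val_one, hBx]
    rw [Finset.sum_eq_single x]
    · simp [hLy]
    · intro a _ hax
      simp [Pi.single_eq_of_ne hax.symm]
    · simp


/-- Interpolation on the Hermitian curve: any function on the affine points of the Hermitian
curve can be interpolated by a bivariate polynomial of `Y`-degree less than `q` all of whose
monomials `X^i Y^j` satisfy `q·i + (q+1)·j < q³ + q² − q`. -/
theorem hermitian_interpolation (p e q : ℕ) (hp : p.Prime) (he : 1 ≤ e) (hq : q = p ^ e)
    (F : Type*) [Field F] [Fintype F] (hF : Fintype.card F = q ^ 2)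
    (r : {xy : F × F // xy.2 ^ q + xy.2 = xy.1 ^ (q + 1)} → F) :
    ∃ R : MvPolynomial (Fin 2) F,
      (∀ d ∈ R.support, d 1 < q ∧ q * d 0 + (q + 1) * d 1 < q ^ 3 + q ^ 2 - q) ∧
      ∀ s : {xy : F × F // xy.2 ^ q + xy.2 = xy.1 ^ (q + 1)},
        MvPolynomial.eval ![s.val.1, s.val.2] R = r s := by
  classical
  have hq1 : 1 < q := hq ▸ Nat.one_lt_pow (by omega) hp.one_lt
  obtain ⟨R, h0, h1, hR⟩ := exists_interpolation_of_card_fibre_le (by omega : 0 < q)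
    (fun x : F => Finset.univ.filter fun y : F => y ^ q + y = x ^ (q + 1))
    (fun x => card_filter_pow_add_self_le hq1 _)
    (fun x y => if h : y ^ q + y = x ^ (q + 1) then r ⟨(x, y), h⟩ else 0)
  refine ⟨R, fun d hd => ?_, fun ⟨⟨x, y⟩, h⟩ => ?_⟩
  · have hd0 := (MvPolynomial.monomial_le_degreeOf 0 hd).trans_lt h0
    have hd1 := (MvPolynomial.monomial_le_degreeOf 1 hd).trans_lt h1
    rw [hF] at hd0
    refine ⟨hd1, ?_⟩
    rw [Nat.lt_sub_iff_add_lt]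
    nlinarith [Nat.mul_le_mul_left q hd0, Nat.mul_le_mul_left (q + 1) hd1]
  · rw [hR x y (by simpa using h), dif_pos h]
end

section
/- Let p be a prime, e ≥ 1, q = p^e, let F be a finite field with q² elements, and let S = {(x, y) ∈ F × F : y^q + y = x^{q+1}}. Let m be a natural number with m < q³, and let R ∈ F[X, Y] be a nonzero polynomial whose degree in Y is less than q and such that every monomial X^i Y^j occurring in R satisfies q·i + (q+1)·j ≤ m. Then the number of points (x, y) ∈ S with R(x, y) = 0 is at most m. In particular, the one-point Hermitian code of length n = q³ and parameter m_H = m has minimum distance at least n − m_H. -/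
/-- The Hermitian degree of the monomial with exponent vector `d`. -/
def hermitianDegree (q : ℕ) (d : Fin 2 →₀ ℕ) : ℕ :=
  q * d 0 + (q + 1) * d 1

/-- The exponents `(i, j)`, `j < q`, of the standard monomials modulo the Hermitian equation and a
polynomial with leading exponent `(a, b)`. -/
def hermitianFootprint (q a b : ℕ) : Finset (ℕ × ℕ) :=
  (Finset.range (a + q + 1) ×ˢ Finset.range b) ∪ (Finset.range a ×ˢ Finset.Ico b q)

theorem card_hermitianFootprint_le {q a b : ℕ} (hb : b < q) :
    (hermitianFootprint q a b).card ≤ q * a + (q + 1) * b := by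
  refine (Finset.card_union_le _ _).trans ?_
  simp only [Finset.card_product, Finset.card_range, Nat.card_Ico]
  obtain ⟨c, rfl⟩ := Nat.exists_eq_add_of_lt hb
  have : b + c + 1 - b = c + 1 := by omega
  rw [this]
  apply le_of_eq
  ring

theorem hermitianDegree_injOn {q : ℕ} {d d' : Fin 2 →₀ ℕ} (hd : d 1 < q) (hd' : d' 1 < q)
    (h : hermitianDegree q d = hermitianDegree q d') : d = d' := by
  unfold hermitianDegree at h
  have h1 : d 1 = d' 1 := by
    have := congrArg (· % q) (show d 1 + q * (d 0 + d 1) = d' 1 + q * (d' 0 + d' 1) by linarith)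
    simpa [Nat.mod_eq_of_lt hd, Nat.mod_eq_of_lt hd'] using this
  have h0 : d 0 = d' 0 := by
    rw [h1] at h
    exact Nat.eq_of_mul_eq_mul_left (by omega : 0 < q) (Nat.add_right_cancel h)
  ext k
  fin_cases k
  · exact h0
  · exact h1

/-- A nonzero polynomial of `Y`-degree less than `q` has a unique monomial of largest Hermitian
degree. -/
theorem exists_hermitianDegree_leading {F : Type*} [CommSemiring F] {q : ℕ}
    {R : MvPolynomial (Fin 2) F} (hR : R ≠ 0) (hdeg : ∀ d ∈ R.support, d 1 < q) :
    ∃ d₀ ∈ R.support, ∀ d ∈ R.support, d ≠ d₀ → hermitianDegree q d < hermitianDegree q d₀ := by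
  obtain ⟨d₀, h₀, hmax⟩ := R.support.exists_max_image (hermitianDegree q)
    (MvPolynomial.support_nonempty.mpr hR)
  exact ⟨d₀, h₀, fun d hd hne => lt_of_le_of_ne (hmax d hd)
    fun h => hne (hermitianDegree_injOn (hdeg d hd) (hdeg d₀ h₀) h)⟩

section

variable {F V : Type*} [Field F] [CommRing V] [Algebra F V]

/-- A multiple of the leading monomial of a vanishing polynomial lies in every subspace containing
all monomials of smaller Hermitian degree. -/
theorem leading_multiple_mem {q : ℕ} {x y : V} {R : MvPolynomial (Fin 2) F}
    (hRxy : MvPolynomial.aeval ![x, y] R = 0) {d₀ : Fin 2 →₀ ℕ} (h₀ : d₀ ∈ R.support)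
    (hlead : ∀ d ∈ R.support, d ≠ d₀ → hermitianDegree q d < hermitianDegree q d₀)
    (U : Submodule F V) {i j : ℕ} (hi : d₀ 0 ≤ i) (hj : d₀ 1 ≤ j)
    (hU : ∀ i' j', q * i' + (q + 1) * j' < q * i + (q + 1) * j → x ^ i' * y ^ j' ∈ U) :
    x ^ i * y ^ j ∈ U := by
  obtain ⟨s, rfl⟩ := Nat.exists_eq_add_of_le' hi
  obtain ⟨t, rfl⟩ := Nat.exists_eq_add_of_le' hj
  have hsum : ∑ d ∈ R.support, R.coeff d • (x ^ (s + d 0) * y ^ (t + d 1)) = 0 := by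
    rw [MvPolynomial.aeval_def, MvPolynomial.eval₂_eq'] at hRxy
    have := congrArg (x ^ s * y ^ t * ·) hRxy
    simp only [mul_zero, Finset.mul_sum] at this
    rw [← this]
    refine Finset.sum_congr rfl fun d _ => ?_
    simp only [Fin.prod_univ_two, Algebra.smul_def, Matrix.cons_val_zero, Matrix.cons_val_one]
    ring
  rw [← Finset.add_sum_erase _ _ h₀] at hsum
  have hmem : R.coeff d₀ • (x ^ (s + d₀ 0) * y ^ (t + d₀ 1)) ∈ U := by
    rw [eq_neg_of_add_eq_zero_left hsum]
    refine U.neg_mem (U.sum_mem fun d hd => U.smul_mem _ (hU _ _ ?_))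
    have := hlead d (Finset.mem_of_mem_erase hd) (Finset.ne_of_mem_erase hd)
    unfold hermitianDegree at this
    linarith
  exact (U.smul_mem_iff (MvPolynomial.mem_support_iff.mp h₀)).mp hmem

/-- The standard monomials span all monomials in a quotient of the Hermitian coordinate ring in
which the polynomial `R` vanishes. -/
theorem monomial_mem_span_hermitianFootprint {q : ℕ} (hq : 2 ≤ q) {x y : V}
    (hxy : y ^ q + y = x ^ (q + 1)) {R : MvPolynomial (Fin 2) F}
    (hRxy : MvPolynomial.aeval ![x, y] R = 0) {d₀ : Fin 2 →₀ ℕ} (h₀ : d₀ ∈ R.support)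
    (hb : d₀ 1 < q)
    (hlead : ∀ d ∈ R.support, d ≠ d₀ → hermitianDegree q d < hermitianDegree q d₀) (i j : ℕ) :
    x ^ i * y ^ j ∈ Submodule.span F (Set.range fun k : hermitianFootprint q (d₀ 0) (d₀ 1) =>
      x ^ k.1.1 * y ^ k.1.2) := by
  set U := Submodule.span F (Set.range fun k : hermitianFootprint q (d₀ 0) (d₀ 1) =>
      x ^ k.1.1 * y ^ k.1.2)
  induction hw : q * i + (q + 1) * j using Nat.strong_induction_on generalizing i j with
  | _ w IH =>
  subst hw
  have hU : ∀ i' j', q * i' + (q + 1) * j' < q * i + (q + 1) * j → x ^ i' * y ^ j' ∈ U :=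
    fun i' j' h => IH _ h i' j' rfl
  clear IH
  induction j using Nat.strong_induction_on generalizing i with
  | _ j IHj =>
  rcases le_or_gt q j with hqj | hjq
  · obtain ⟨t, rfl⟩ := Nat.exists_eq_add_of_le' hqj
    have hrw : x ^ i * y ^ (t + q) = x ^ (i + (q + 1)) * y ^ t - x ^ i * y ^ (t + 1) := by
      rw [pow_add x i (q + 1), ← hxy]
      ring
    have hdeg : q * (i + (q + 1)) + (q + 1) * t = q * i + (q + 1) * (t + q) := by ring
    rw [hrw]
    refine U.sub_mem (IHj t (by omega) _ (by rwa [hdeg])) (hU _ _ ?_)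
    nlinarith
  by_cases hmem : (i, j) ∈ hermitianFootprint q (d₀ 0) (d₀ 1)
  · exact Submodule.subset_span ⟨⟨(i, j), hmem⟩, rfl⟩
  simp only [hermitianFootprint, Finset.mem_union, Finset.mem_product, Finset.mem_range,
    Finset.mem_Ico] at hmem
  rcases le_or_gt (d₀ 1) j with hj | hj
  · exact leading_multiple_mem hRxy h₀ hlead U (by omega) hj hU
  · obtain ⟨s, rfl⟩ := Nat.exists_eq_add_of_le' (show q + 1 ≤ i by omega)
    have hrw : x ^ (s + (q + 1)) * y ^ j = x ^ s * y ^ (j + q) + x ^ s * y ^ (j + 1) := by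
      rw [pow_add x s (q + 1), ← hxy]
      ring
    have hdeg : q * s + (q + 1) * (j + q) = q * (s + (q + 1)) + (q + 1) * j := by ring
    rw [hrw]
    refine U.add_mem (leading_multiple_mem hRxy h₀ hlead U (by omega) (by omega) ?_)
      (hU _ _ ?_)
    · rwa [hdeg]
    · nlinarith

end

/-- If all products of powers of the coordinates lie in a subspace of the functions on a set of
points over a finite field, then the subspace contains all functions. -/
theorem eq_top_of_coordinate_monomial_mem {F : Type*} [Field F] [Finite F] {P : F × F → Prop}
    (U : Submodule F ({z // P z} → F))
    (hU : ∀ i j : ℕ, (fun z : {z // P z} => z.1.1) ^ i * (fun z => z.1.2) ^ j ∈ U) : U = ⊤ := by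
  classical
  refine eq_top_iff.mpr fun f _ => ?_
  let g : (Fin 2 → F) → F := fun v => if h : P (v 0, v 1) then f ⟨_, h⟩ else 0
  have hg : g ∈ (⊤ : Submodule F ((Fin 2 → F) → F)) := trivial
  let _ := Fintype.ofFinite F
  rw [← MvPolynomial.map_restrict_dom_evalₗ] at hg
  obtain ⟨Q, -, hQ⟩ := hg
  have hf : f = ∑ d ∈ Q.support,
      Q.coeff d • ((fun z : {z // P z} => z.1.1) ^ d 0 * (fun z => z.1.2) ^ d 1) := by
    funext z
    have := congrFun hQ ![z.1.1, z.1.2]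
    rw [MvPolynomial.evalₗ_apply, MvPolynomial.eval_eq'] at this
    simpa [g, z.2] using this.symm
  rw [hf]
  exact U.sum_mem fun d _ => U.smul_mem _ (hU _ _)


/-- A nonzero bivariate polynomial of `Y`-degree less than `q`, all of whose monomials
`X^i Y^j` satisfy `q·i + (q+1)·j ≤ m` with `m < q³`, has at most `m` zeros among the affine
rational points of the Hermitian curve.  In particular, the one-point Hermitian code of
length `n = q³` and parameter `m_H = m` has minimum distance at least `n − m_H`. -/
theorem hermitian_zero_count (p e q : ℕ) (hp : p.Prime) (he : 1 ≤ e) (hq : q = p ^ e)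
    (F : Type*) [Field F] [Fintype F] (hF : Fintype.card F = q ^ 2)
    (m : ℕ) (hm : m < q ^ 3) (R : MvPolynomial (Fin 2) F) (hR : R ≠ 0)
    (hdeg : ∀ d ∈ R.support, d 1 < q ∧ q * d 0 + (q + 1) * d 1 ≤ m) :
    Nat.card {xy : F × F //
        xy.2 ^ q + xy.2 = xy.1 ^ (q + 1) ∧ MvPolynomial.eval ![xy.1, xy.2] R = 0} ≤ m := by
  classical
  have hq2 : 2 ≤ q := by
    rw [hq]
    exact hp.two_le.trans (Nat.le_self_pow (by omega) p)
  obtain ⟨d₀, h₀, hlead⟩ := exists_hermitianDegree_leading hR fun d hd => (hdeg d hd).1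
  obtain ⟨hb, hd₀⟩ := hdeg d₀ h₀
  let P : F × F → Prop := fun xy =>
    xy.2 ^ q + xy.2 = xy.1 ^ (q + 1) ∧ MvPolynomial.eval ![xy.1, xy.2] R = 0
  let x : {z // P z} → F := fun z => z.1.1
  let y : {z // P z} → F := fun z => z.1.2
  have hxy : y ^ q + y = x ^ (q + 1) := funext fun z => z.2.1
  have hRxy : MvPolynomial.aeval ![x, y] R = 0 := by
    funext z
    refine Eq.trans ?_ z.2.2
    simp [MvPolynomial.aeval_def, MvPolynomial.eval₂_eq', MvPolynomial.eval_eq', x, y]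
  have htop := eq_top_of_coordinate_monomial_mem _
    (monomial_mem_span_hermitianFootprint hq2 hxy hRxy h₀ hb hlead)
  have hcard := finrank_range_le_card (R := F)
    fun k : hermitianFootprint q (d₀ 0) (d₀ 1) => x ^ k.1.1 * y ^ k.1.2
  rw [Set.finrank, htop, finrank_top, Module.finrank_fintype_fun_eq_card, Fintype.card_coe] at hcard
  rw [Nat.card_eq_fintype_card]
  exact hcard.trans ((card_hermitianFootprint_le hb).trans hd₀)
end

section
/- Let p be a prime, e ≥ 1, q = p^e, and let F be a finite field with q² elements. Then the polynomial Y^q + Y − X^{q+1} is irreducible in F[X, Y]; equivalently, the quotient ring F[X, Y]/(Y^q + Y − X^{q+1}) is an integral domain. -/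
/-- Eisenstein's criterion for a binomial `X ^ n - c`. -/
theorem irreducible_X_pow_sub_C_of_prime {R : Type*} [CommRing R] [IsDomain R] {n : ℕ}
    (hn : n ≠ 0) {a c : R} (ha : Prime a) (hdvd : a ∣ c) (hsq : ¬ a ^ 2 ∣ c) :
    Irreducible (Polynomial.X ^ n - Polynomial.C c) := by
  have hmonic : (Polynomial.X ^ n - Polynomial.C c).Monic := Polynomial.monic_X_pow_sub_C c hn
  have hprime : (Ideal.span {a}).IsPrime := (Ideal.span_singleton_prime ha.ne_zero).2 ha
  have hdeg : (Polynomial.X ^ n - Polynomial.C c).natDegree = n :=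
    Polynomial.natDegree_X_pow_sub_C
  refine (hmonic.isEisensteinAt_of_mem_of_notMem hprime.ne_top ?_ ?_).irreducible hprime
    hmonic.isPrimitive (by omega)
  · intro i hi
    rw [hdeg] at hi
    rw [Polynomial.coeff_sub, Polynomial.coeff_X_pow, if_neg hi.ne, zero_sub, Polynomial.coeff_C,
      neg_mem_iff, Ideal.mem_span_singleton]
    split_ifs
    · exact hdvd
    · exact dvd_zero a
  · rwa [Ideal.span_singleton_pow, Ideal.mem_span_singleton, Polynomial.coeff_sub,
      Polynomial.coeff_X_pow, if_neg hn.symm, zero_sub, Polynomial.coeff_C_zero, dvd_neg]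

/-- If `2 ≤ n` and `a` is prime, then `a ^ 2` does not divide `a ^ n + a`. -/
theorem Prime.not_sq_dvd_pow_add_self {R : Type*} [CommRing R] [IsDomain R] {a : R}
    (ha : Prime a) {n : ℕ} (hn : 2 ≤ n) : ¬ a ^ 2 ∣ a ^ n + a := by
  rw [dvd_add_right (pow_dvd_pow a hn)]
  intro h
  have := (pow_dvd_pow_iff ha.ne_zero ha.not_isUnit (n := 2) (m := 1)).1 (by simpa using h)
  omega

/-- The polynomial `Y ^ n + Y - X ^ m` is irreducible over any field if `2 ≤ n` and `m ≠ 0`. -/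
theorem MvPolynomial.irreducible_X_one_pow_add_X_one_sub_X_zero_pow (F : Type*) [Field F]
    {n m : ℕ} (hn : 2 ≤ n) (hm : m ≠ 0) :
    Irreducible (X 1 ^ n + X 1 - X 0 ^ m : MvPolynomial (Fin 2) F) := by
  rw [← MulEquiv.irreducible_iff (finSuccEquiv F 1),
    ← (Associated.refl _).neg_left.irreducible_iff]
  have hX : Prime (X 0 : MvPolynomial (Fin 1) F) := X_prime
  have h1 : finSuccEquiv F 1 (X 1) = Polynomial.C (X 0) := finSuccEquiv_X_succ (j := 0)
  convert irreducible_X_pow_sub_C_of_prime hm hX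
    (dvd_add (dvd_pow_self _ (by omega)) dvd_rfl) (hX.not_sq_dvd_pow_add_self hn) using 1
  simp only [map_sub, map_add, map_pow, h1, finSuccEquiv_X_zero, neg_sub]

/-- The defining polynomial `Y^q + Y − X^(q+1)` of the Hermitian curve is irreducible over
the field with `q²` elements; equivalently, the coordinate ring
`F[X,Y]/(Y^q + Y − X^(q+1))` is an integral domain. -/
theorem hermitian_polynomial_irreducible (p e q : ℕ) (hp : p.Prime) (he : 1 ≤ e)
    (hq : q = p ^ e) (F : Type*) [Field F] [Fintype F] (hF : Fintype.card F = q ^ 2) :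
    Irreducible
        (MvPolynomial.X 1 ^ q + MvPolynomial.X 1 - MvPolynomial.X 0 ^ (q + 1) :
          MvPolynomial (Fin 2) F) ∧
      IsDomain
        (MvPolynomial (Fin 2) F ⧸
          Ideal.span
            {(MvPolynomial.X 1 ^ q + MvPolynomial.X 1 - MvPolynomial.X 0 ^ (q + 1) :
              MvPolynomial (Fin 2) F)}) := by
  have hq2 : 2 ≤ q := hq ▸ hp.two_le.trans (Nat.le_self_pow (by omega) p)
  have hirr := MvPolynomial.irreducible_X_one_pow_add_X_one_sub_X_zero_pow F hq2 q.succ_ne_zero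
  exact ⟨hirr, (Ideal.Quotient.isDomain_iff_prime _).2
    ((Ideal.span_singleton_prime hirr.ne_zero).2 hirr.prime)⟩
end

section
/- Let q ≥ 2 be an integer, S_q = {q·i + (q+1)·j : i, j ∈ ℕ}, and g = q(q−1)/2. Then for every natural number m with m ≥ 2g − 1, the number of elements of S_q that are at most m is exactly m + 1 − g. Equivalently, the number of pairs (i, j) ∈ ℕ × ℕ with j < q and q·i + (q+1)·j ≤ m equals m + 1 − g. -/
theorem mem_semigroup_iff {q : ℕ} (hq : 0 < q) (n : ℕ) :
    (∃ i j : ℕ, n = q * i + (q + 1) * j) ↔ n % q ≤ n / q := by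
  constructor
  · rintro ⟨i, j, rfl⟩
    have h : q * i + (q + 1) * j = j + q * (i + j) := by ring
    rw [h, Nat.add_mul_mod_self_left, Nat.add_mul_div_left _ _ hq]
    exact (Nat.mod_le j q).trans ((Nat.le_add_left j i).trans (Nat.le_add_left _ _))
  · intro h
    refine ⟨n / q - n % q, n % q, ?_⟩
    obtain ⟨d, hd⟩ := Nat.exists_eq_add_of_le h
    have hn := Nat.div_add_mod n q
    rw [hd] at hn ⊢
    rw [Nat.add_sub_cancel_left]
    nth_rewrite 1 [← hn]
    ring

theorem injOn_monomial_degree {q : ℕ} (hq : 0 < q) :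
    Set.InjOn (fun ij : ℕ × ℕ => q * ij.1 + (q + 1) * ij.2) {ij | ij.2 < q} := by
  rintro ⟨i, j⟩ hj ⟨k, l⟩ hl h
  simp only [Set.mem_ofPred_eq] at hj hl h
  have h' : j + q * (i + j) = l + q * (k + l) := by linarith
  have hmod := congrArg (· % q) h'
  have hdiv := congrArg (· / q) h'
  simp only [Nat.add_mul_mod_self_left, Nat.add_mul_div_left _ _ hq, Nat.mod_eq_of_lt hj,
    Nat.mod_eq_of_lt hl, Nat.div_eq_of_lt hj, Nat.div_eq_of_lt hl] at hmod hdiv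
  ext <;> simp only <;> omega

theorem image_monomial_degree {q : ℕ} (hq : 0 < q) (m : ℕ) :
    (fun ij : ℕ × ℕ => q * ij.1 + (q + 1) * ij.2) ''
        {ij | ij.2 < q ∧ q * ij.1 + (q + 1) * ij.2 ≤ m} =
      {n | (∃ i j : ℕ, n = q * i + (q + 1) * j) ∧ n ≤ m} := by
  ext n
  constructor
  · rintro ⟨⟨i, j⟩, ⟨-, h⟩, rfl⟩
    exact ⟨⟨i, j, rfl⟩, h⟩
  · rintro ⟨hn, hm⟩
    obtain ⟨d, hd⟩ := Nat.exists_eq_add_of_le ((mem_semigroup_iff hq n).1 hn)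
    have hdeg : q * d + (q + 1) * (n % q) = n := by
      conv_rhs => rw [← Nat.div_add_mod n q, hd]
      ring
    exact ⟨(d, n % q), ⟨Nat.mod_lt n hq, hdeg.trans_le hm⟩, hdeg⟩

theorem card_gaps {q m : ℕ} (hq : 0 < q) (hm : q * (q - 1) - 1 ≤ m) :
    ((Finset.range (m + 1)).filter fun n => ¬ n % q ≤ n / q).card = q * (q - 1) / 2 := by
  rw [← Finset.sum_range_id, ← Finset.sum_congr rfl fun b _ => Finset.card_range b,
    ← Finset.card_sigma]
  refine Finset.card_bij' (fun n _ => ⟨n % q, n / q⟩) (fun p _ => q * p.2 + p.1) ?_ ?_ ?_ ?_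
  · intro n hn
    simp only [Finset.mem_filter, not_le] at hn
    simpa using ⟨Nat.mod_lt n hq, hn.2⟩
  · rintro ⟨b, a⟩ hp
    simp only [Finset.mem_sigma, Finset.mem_range] at hp
    obtain ⟨hb, ha⟩ := hp
    simp only [Finset.mem_filter, Finset.mem_range, Nat.mul_add_mod, Nat.mod_eq_of_lt hb,
      Nat.mul_add_div hq, Nat.div_eq_of_lt hb]
    obtain ⟨c, rfl⟩ : ∃ c, q = c + 2 := ⟨q - 2, by omega⟩
    have hac : (c + 2) * a ≤ (c + 2) * c := Nat.mul_le_mul_left _ (by omega)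
    have hexp : (c + 2) * (c + 2 - 1) = (c + 2) * c + (c + 2) := by
      rw [show c + 2 - 1 = c + 1 by omega]; ring
    omega
  · intro n _
    exact Nat.div_add_mod n q
  · rintro ⟨b, a⟩ hp
    simp only [Finset.mem_sigma, Finset.mem_range] at hp
    simp [Nat.mod_eq_of_lt hp.1, Nat.mul_add_div hq, Nat.div_eq_of_lt hp.1]

/-- For `m ≥ 2g − 1` with `g = q(q−1)/2`, the number of elements of the numerical semigroup
generated by `q` and `q+1` that are at most `m` is exactly `m + 1 − g`; equivalently, the
number of pairs `(i, j)` with `j < q` and `q·i + (q+1)·j ≤ m` is `m + 1 − g`. -/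
theorem semigroup_count_below (q : ℕ) (hq : 2 ≤ q) (m : ℕ) (hm : 2 * (q * (q - 1) / 2) - 1 ≤ m) :
    {n : ℕ | (∃ i j : ℕ, n = q * i + (q + 1) * j) ∧ n ≤ m}.ncard = m + 1 - q * (q - 1) / 2 ∧
      {ij : ℕ × ℕ | ij.2 < q ∧ q * ij.1 + (q + 1) * ij.2 ≤ m}.ncard
        = m + 1 - q * (q - 1) / 2 := by
  have hq0 : 0 < q := by omega
  rw [Nat.mul_div_cancel' (Nat.even_mul_pred_self q).two_dvd] at hm
  have hS : {n : ℕ | (∃ i j : ℕ, n = q * i + (q + 1) * j) ∧ n ≤ m}.ncard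
      = m + 1 - q * (q - 1) / 2 := by
    have hset : {n : ℕ | (∃ i j : ℕ, n = q * i + (q + 1) * j) ∧ n ≤ m} =
        ((Finset.range (m + 1)).filter fun n => n % q ≤ n / q : Finset ℕ) := by
      ext n
      simp [mem_semigroup_iff hq0, and_comm]
    rw [hset, Set.ncard_coe_finset]
    have hcard := Finset.card_filter_add_card_filter_not (s := Finset.range (m + 1))
      (fun n => n % q ≤ n / q)
    rw [card_gaps hq0 hm, Finset.card_range] at hcard
    omega
  refine ⟨hS, ?_⟩
  rw [← hS, ← image_monomial_degree hq0 m]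
  exact (((injOn_monomial_degree hq0).mono fun _ h => h.1).ncard_image).symm
end

section
/- Let p be a prime, e ≥ 1, q = p^e, let F be a finite field with q² elements, let S = {(x, y) ∈ F × F : y^q + y = x^{q+1}}, and let g = q(q−1)/2. Let m_H be a natural number with 2(g−1) < m_H < q³. Then the F-linear subspace of the space of functions S → F spanned by the evaluation functions (x, y) ↦ x^i·y^j, over all pairs (i, j) ∈ ℕ × ℕ with j < q and q·i + (q+1)·j ≤ m_H, has dimension m_H − g + 1. In particular, the one-point Hermitian code of length n = q³ and parameter m_H has dimension k = m_H − g + 1. -/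
/-- The span of the monomials `x ^ i * y ^ j` of Hermitian degree `q * i + (q + 1) * j < d`. -/
def hermitianLT (F : Type*) {A : Type*} [Field F] [CommRing A] [Algebra F A] (q : ℕ) (x y : A)
    (d : ℕ) : Submodule F A :=
  Submodule.span F {f | ∃ i j : ℕ, q * i + (q + 1) * j < d ∧ f = x ^ i * y ^ j}

section Filtration

variable {F A : Type*} [Field F] [CommRing A] [Algebra F A] {q : ℕ} {x y : A}

theorem monomial_mem_hermitianLT {d i j : ℕ} (h : q * i + (q + 1) * j < d) :
    x ^ i * y ^ j ∈ hermitianLT F q x y d :=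
  Submodule.subset_span ⟨i, j, h, rfl⟩

theorem monomial_mul_mem_hermitianLT {d : ℕ} (a b : ℕ) {f : A} (hf : f ∈ hermitianLT F q x y d) :
    x ^ a * y ^ b * f ∈ hermitianLT F q x y (d + (q * a + (q + 1) * b)) := by
  unfold hermitianLT at hf
  induction hf using Submodule.span_induction with
  | mem f hf =>
    obtain ⟨i, j, h, rfl⟩ := hf
    have : x ^ a * y ^ b * (x ^ i * y ^ j) = x ^ (a + i) * y ^ (b + j) := by ring
    rw [this]
    apply monomial_mem_hermitianLT
    linarith
  | zero => simp
  | add f g _ _ hf hg => rw [mul_add]; exact add_mem hf hg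
  | smul c f _ hf => rw [mul_smul_comm]; exact Submodule.smul_mem _ _ hf

theorem exists_reduced_monomial (hq : 2 ≤ q) (hxy : y ^ q + y = x ^ (q + 1)) (j i : ℕ) :
    ∃ i' j' : ℕ, j' < q ∧ q * i' + (q + 1) * j' = q * i + (q + 1) * j ∧
      x ^ i * y ^ j - x ^ i' * y ^ j' ∈ hermitianLT F q x y (q * i + (q + 1) * j) := by
  induction j using Nat.strong_induction_on generalizing i with
  | _ j ih =>
    rcases lt_or_ge j q with hj | hj
    · exact ⟨i, j, hj, rfl, by simp⟩
    · obtain ⟨k, rfl⟩ := Nat.exists_eq_add_of_le' hj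
      obtain ⟨i', j', hj', hdeg, hmem⟩ := ih k (by omega) (i + (q + 1))
      have hd : q * (i + (q + 1)) + (q + 1) * k = q * i + (q + 1) * (k + q) := by ring
      rw [hd] at hdeg hmem
      refine ⟨i', j', hj', hdeg, ?_⟩
      have hlow : x ^ i * y ^ (k + 1) ∈ hermitianLT F q x y (q * i + (q + 1) * (k + q)) := by
        apply monomial_mem_hermitianLT
        nlinarith
      have : x ^ i * y ^ (k + q) - x ^ i' * y ^ j' =
          (x ^ (i + (q + 1)) * y ^ k - x ^ i' * y ^ j') - x ^ i * y ^ (k + 1) := by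
        rw [pow_add x i (q + 1), ← hxy]; ring
      rw [this]
      exact sub_mem hmem hlow

theorem hermitianDegree_injective {i j i' j' : ℕ} (hj : j < q) (hj' : j' < q)
    (h : q * i + (q + 1) * j = q * i' + (q + 1) * j') : i = i' ∧ j = j' := by
  have h1 : (q * (i + j) + j) % q = (q * (i' + j') + j') % q := by
    congr 1; linarith
  rw [Nat.mul_add_mod, Nat.mul_add_mod, Nat.mod_eq_of_lt hj, Nat.mod_eq_of_lt hj'] at h1
  subst h1
  exact ⟨Nat.eq_of_mul_eq_mul_left (by omega : 0 < q) (by omega), rfl⟩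

theorem monomial_sub_mem_hermitianLT (hq : 2 ≤ q) (hxy : y ^ q + y = x ^ (q + 1)) {i j i' j' : ℕ}
    (h : q * i + (q + 1) * j = q * i' + (q + 1) * j') :
    x ^ i * y ^ j - x ^ i' * y ^ j' ∈ hermitianLT F q x y (q * i + (q + 1) * j) := by
  obtain ⟨a, b, hb, hd, hm⟩ := exists_reduced_monomial (F := F) hq hxy j i
  obtain ⟨a', b', hb', hd', hm'⟩ := exists_reduced_monomial (F := F) hq hxy j' i'
  obtain ⟨rfl, rfl⟩ := hermitianDegree_injective hb hb' (by rw [hd, hd', h])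
  rw [← h] at hm'
  simpa using sub_mem hm hm'

theorem monomial_mem_hermitianLT_of_degree_eq_add (hq : 2 ≤ q) (hxy : y ^ q + y = x ^ (q + 1))
    {i j a b c d : ℕ} (h : x ^ i * y ^ j ∈ hermitianLT F q x y (q * i + (q + 1) * j))
    (hd : q * a + (q + 1) * b = (q * i + (q + 1) * j) + (q * c + (q + 1) * d)) :
    x ^ a * y ^ b ∈ hermitianLT F q x y (q * a + (q + 1) * b) := by
  have h1 := monomial_mul_mem_hermitianLT c d h
  rw [← hd] at h1
  have h2 := monomial_sub_mem_hermitianLT (F := F) hq hxy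
    (i := a) (j := b) (i' := c + i) (j' := d + j) (by rw [hd]; ring)
  have : x ^ a * y ^ b =
      (x ^ a * y ^ b - x ^ (c + i) * y ^ (d + j)) + x ^ c * y ^ d * (x ^ i * y ^ j) := by ring
  rw [this]
  exact add_mem h2 h1

theorem monomial_mem_of_sub_mem_hermitianLT (T : Submodule F A)
    (h : ∀ i j : ℕ, ∃ b ∈ T, x ^ i * y ^ j - b ∈ hermitianLT F q x y (q * i + (q + 1) * j))
    (i j : ℕ) : x ^ i * y ^ j ∈ T := by
  induction hd : q * i + (q + 1) * j using Nat.strong_induction_on generalizing i j with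
  | _ d ih =>
    obtain ⟨b, hb, hm⟩ := h i j
    have hle : hermitianLT F q x y (q * i + (q + 1) * j) ≤ T := by
      refine Submodule.span_le.2 ?_
      rintro _ ⟨i', j', hlt, rfl⟩
      exact ih _ (hd ▸ hlt) i' j' rfl
    simpa using add_mem (hle hm) hb

/-- If a monomial of degree `m` is congruent to zero modulo lower degrees, the monomials of degree
in the Apéry set of `m` suffice to generate. -/
theorem exists_finset_span_monomial (hq : 2 ≤ q) (hxy : y ^ q + y = x ^ (q + 1)) {i j : ℕ}
    (h : x ^ i * y ^ j ∈ hermitianLT F q x y (q * i + (q + 1) * j)) :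
    ∃ B : Finset A, B.card ≤ q * i + (q + 1) * j ∧
      ∀ a b : ℕ, x ^ a * y ^ b ∈ Submodule.span F (B : Set A) := by
  classical
  set m := q * i + (q + 1) * j with hm
  let P : Set ℕ := {n | (∃ a b : ℕ, n = q * a + (q + 1) * b) ∧
    ¬ ∃ c d : ℕ, n = m + (q * c + (q + 1) * d)}
  have hmaps : Set.MapsTo (· % m) P (Finset.range m : Set ℕ) := by
    rintro n ⟨⟨a, b, hn⟩, hn'⟩
    have : m ≠ 0 := fun h0 => hn' ⟨a, b, by rw [h0, zero_add, hn]⟩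
    simpa using Nat.mod_lt n (Nat.pos_of_ne_zero this)
  have key : ∀ n ∈ P, ∀ n' ∈ P, n % m = n' % m → n < n' → False := by
    rintro n ⟨⟨a, b, hn⟩, -⟩ n' ⟨-, hn'⟩ hmod hlt
    obtain ⟨k, hk⟩ := (Nat.modEq_iff_dvd' hlt.le).1 hmod
    obtain ⟨l, rfl⟩ : ∃ l, k = l + 1 := ⟨k - 1, by
      rcases k with _ | k
      · simp at hk; omega
      · simp⟩
    refine hn' ⟨a + l * i, b + l * j, ?_⟩
    have h1 : n' = n + m * (l + 1) := by omega
    rw [h1, hn, hm]; ring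
  have hinj : Set.InjOn (· % m) P := by
    intro n hn n' hn' hmod
    rcases lt_trichotomy n n' with hlt | rfl | hlt
    · exact (key n hn n' hn' hmod hlt).elim
    · rfl
    · exact (key n' hn' n hn hmod.symm hlt).elim
  have hfin : P.Finite := Set.Finite.of_injOn hmaps hinj (Finset.finite_toSet _)
  have hcard : hfin.toFinset.card ≤ m := by
    rw [← Finset.card_range m]
    refine Finset.card_le_card_of_injOn (· % m) ?_ ?_
    · simpa using hmaps
    · simpa using hinj
  have hex : ∀ n : ℕ, ∃ f : A, n ∈ P → ∃ a b : ℕ, n = q * a + (q + 1) * b ∧ f = x ^ a * y ^ b := by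
    intro n
    by_cases hn : n ∈ P
    · obtain ⟨a, b, hab⟩ := hn.1
      exact ⟨_, fun _ => ⟨a, b, hab, rfl⟩⟩
    · exact ⟨0, fun h => (hn h).elim⟩
  choose f hf using hex
  refine ⟨hfin.toFinset.image f, Finset.card_image_le.trans hcard, ?_⟩
  refine monomial_mem_of_sub_mem_hermitianLT (q := q) _ fun a b => ?_
  by_cases hab : ∃ c d : ℕ, q * a + (q + 1) * b = m + (q * c + (q + 1) * d)
  · obtain ⟨c, d, hcd⟩ := hab
    exact ⟨0, zero_mem _, by
      simpa using monomial_mem_hermitianLT_of_degree_eq_add hq hxy h hcd⟩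
  · have hP : q * a + (q + 1) * b ∈ P := ⟨⟨a, b, rfl⟩, hab⟩
    obtain ⟨a', b', hd, hfe⟩ := hf _ hP
    refine ⟨f (q * a + (q + 1) * b), Submodule.subset_span ?_, ?_⟩
    · simpa using ⟨_, hP, rfl⟩
    · rw [hfe]
      exact monomial_sub_mem_hermitianLT hq hxy hd

theorem linearIndependent_monomial {s : Finset (ℕ × ℕ)} (hs : ∀ u ∈ s, u.2 < q)
    (h : ∀ u ∈ s, x ^ u.1 * y ^ u.2 ∉ hermitianLT F q x y (q * u.1 + (q + 1) * u.2)) :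
    LinearIndependent F (fun u : s => x ^ u.1.1 * y ^ u.1.2) := by
  classical
  rw [Fintype.linearIndependent_iff]
  intro c hc
  by_contra! hne
  obtain ⟨u₀, hu₀⟩ := hne
  obtain ⟨u, hu, hmax⟩ := Finset.exists_max_image
    (Finset.univ.filter fun u : s => c u ≠ 0) (fun u => q * u.1.1 + (q + 1) * u.1.2)
    ⟨u₀, by simpa using hu₀⟩
  have hcu : c u ≠ 0 := by simpa using hu
  refine h u.1 u.2 ?_
  rw [← Finset.add_sum_erase _ _ (Finset.mem_univ u)] at hc
  rw [← Submodule.smul_mem_iff _ hcu, eq_neg_of_add_eq_zero_left hc]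
  refine neg_mem (sum_mem fun v hv => ?_)
  by_cases hcv : c v = 0
  · simp [hcv]
  refine Submodule.smul_mem _ _ (monomial_mem_hermitianLT (lt_of_le_of_ne ?_ ?_))
  · exact hmax v (by simpa using hcv)
  · intro heq
    obtain ⟨h1, h2⟩ := hermitianDegree_injective (hs _ v.2) (hs _ u.2) heq
    exact Finset.ne_of_mem_erase hv (Subtype.ext (Prod.ext h1 h2))

end Filtration

section Counting

theorem sum_range_add_div {q : ℕ} (hq : 0 < q) (n : ℕ) :
    ∑ k ∈ Finset.range q, (n + k) / q = n := by
  induction n with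
  | zero =>
    refine Finset.sum_eq_zero fun k hk => ?_
    rw [zero_add]
    exact Nat.div_eq_of_lt (Finset.mem_range.1 hk)
  | succ n ih =>
    have h1 := Finset.sum_range_succ (fun k => (n + k) / q) q
    have h2 := Finset.sum_range_succ' (fun k => (n + k) / q) q
    have h3 : ∀ k, n + 1 + k = n + (k + 1) := fun k => by ring
    simp only [h3]
    rw [Nat.add_div_right _ hq] at h1
    simp only [add_zero] at h2
    omega

/-- The exponents of the reduced monomials of Hermitian degree at most `m`. -/
def hermitianExponents (q m : ℕ) : Finset (ℕ × ℕ) :=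
  (Finset.range (m + 1) ×ˢ Finset.range q).filter fun u => q * u.1 + (q + 1) * u.2 ≤ m

theorem mem_hermitianExponents {q m : ℕ} {u : ℕ × ℕ} :
    u ∈ hermitianExponents q m ↔ u.2 < q ∧ q * u.1 + (q + 1) * u.2 ≤ m := by
  simp only [hermitianExponents, Finset.mem_filter, Finset.mem_product, Finset.mem_range]
  constructor
  · rintro ⟨⟨-, h1⟩, h2⟩
    exact ⟨h1, h2⟩
  · rintro ⟨h1, h2⟩
    refine ⟨⟨?_, h1⟩, h2⟩
    have : 1 * u.1 ≤ q * u.1 := Nat.mul_le_mul_right _ (by omega)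
    have : 0 ≤ (q + 1) * u.2 := Nat.zero_le _
    omega

theorem card_hermitianExponents {q m : ℕ} (hq : 2 ≤ q) (hm : 2 * (q * (q - 1) / 2 - 1) < m) :
    (hermitianExponents q m).card = m - q * (q - 1) / 2 + 1 := by
  have hq0 : 0 < q := by omega
  obtain ⟨r, rfl⟩ : ∃ r, q = r + 1 := ⟨q - 1, by omega⟩
  have heven : 2 * ((r + 1) * (r + 1 - 1) / 2) = (r + 1) * (r + 1 - 1) :=
    Nat.two_mul_div_two_of_even (Nat.even_mul_pred_self _)
  simp only [Nat.add_sub_cancel] at heven hm ⊢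
  have hcol : (hermitianExponents (r + 1) m).card =
      ∑ j ∈ Finset.range (r + 1), (m + (r + 1) - (r + 1 + 1) * j) / (r + 1) := by
    rw [Finset.card_eq_sum_card_fiberwise (f := Prod.snd) (t := Finset.range (r + 1))]
    · refine Finset.sum_congr rfl fun j hj => ?_
      rw [← Finset.card_range ((m + (r + 1) - (r + 1 + 1) * j) / (r + 1))]
      refine Finset.card_bij (fun u _ => u.1) ?_ ?_ ?_
      · rintro ⟨i, j'⟩ hu
        simp only [Finset.mem_filter, mem_hermitianExponents] at hu
        obtain ⟨⟨-, h⟩, rfl⟩ := hu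
        rw [Finset.mem_range, ← Nat.add_one_le_iff, Nat.le_div_iff_mul_le hq0]
        change (i + 1) * (r + 1) ≤ _
        have : (i + 1) * (r + 1) = (r + 1) * i + (r + 1) := by ring
        omega
      · rintro ⟨i, j'⟩ hu ⟨i', j''⟩ hu' h
        simp only [Finset.mem_filter] at hu hu'
        exact Prod.ext h (hu.2.trans hu'.2.symm)
      · intro i hi
        rw [Finset.mem_range, ← Nat.add_one_le_iff, Nat.le_div_iff_mul_le hq0] at hi
        refine ⟨(i, j), ?_, rfl⟩
        simp only [Finset.mem_filter, mem_hermitianExponents]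
        refine ⟨⟨Finset.mem_range.1 hj, ?_⟩, trivial⟩
        have : (i + 1) * (r + 1) = (r + 1) * i + (r + 1) := by ring
        omega
    · intro u hu
      simpa using (mem_hermitianExponents.1 hu).1
  have hterm : ∀ j ∈ Finset.range (r + 1),
      (m + (r + 1) - (r + 1 + 1) * j) / (r + 1) + j = (m + 1 + (r + 1 - 1 - j)) / (r + 1) := by
    intro j hj
    have hj' : j ≤ r := by simpa [Nat.lt_succ_iff] using hj
    have h1 : (r + 1 + 1) * j ≤ m + (r + 1) := by
      have : (r + 1 + 1) * j ≤ (r + 1 + 1) * r := Nat.mul_le_mul_left _ hj'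
      have : (r + 1 + 1) * r = (r + 1) * r + r := by ring
      omega
    rw [← Nat.add_mul_div_left _ _ hq0]
    congr 1
    have : (r + 1 + 1) * j = (r + 1) * j + j := by ring
    omega
  have hsum := Finset.sum_congr rfl hterm
  rw [Finset.sum_add_distrib, Finset.sum_range_reflect (fun k => (m + 1 + k) / (r + 1)),
    sum_range_add_div hq0, ← hcol, Finset.sum_range_id, Nat.add_sub_cancel] at hsum
  have hpos : 2 ≤ (r + 1) * r := by nlinarith
  omega

end Counting

section Curve

/-- For `F` of order `q ^ 2`, every nonempty fibre of the trace `y ↦ y ^ q + y` has `q` elements,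
so the affine Hermitian curve has at least `q ^ 3` points. -/
theorem card_hermitianCurve_ge {p e q : ℕ} (hp : p.Prime) (he : 1 ≤ e) (hq : q = p ^ e)
    (F : Type*) [Field F] [Fintype F] (hF : Fintype.card F = q ^ 2) :
    q ^ 3 ≤ Nat.card {xy : F × F // xy.2 ^ q + xy.2 = xy.1 ^ (q + 1)} := by
  classical
  have hq2 : 2 ≤ q := hq ▸ hp.two_le.trans (Nat.le_self_pow (by omega) p)
  have := Fact.mk hp
  have : CharP F p :=
    charP_of_card_eq_prime_pow (f := e * 2) (by rw [hF, hq, pow_mul])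
  have hfrob : ∀ a b : F, (a + b) ^ q = a ^ q + b ^ q := by
    intro a b; rw [hq]; exact add_pow_char_pow a b p e
  have hqq : ∀ a : F, (a ^ q) ^ q = a := by
    intro a
    rw [← pow_mul, ← sq, ← hF, FiniteField.pow_card]
  let tr : F →+ F :=
    { toFun := fun y => y ^ q + y
      map_zero' := by simp [show q ≠ 0 by omega]
      map_add' := fun a b => by rw [hfrob]; ring }
  have hker : Nat.card tr.ker ≤ q := by
    have hne : (Polynomial.X ^ q + Polynomial.X : Polynomial F) ≠ 0 := by
      intro h0
      have := congrArg (fun f => Polynomial.coeff f q) h0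
      simp [Polynomial.coeff_X, show (1 : ℕ) ≠ q by omega] at this
    have hdeg : (Polynomial.X ^ q + Polynomial.X : Polynomial F).natDegree ≤ q := by
      refine Polynomial.natDegree_add_le_of_degree_le (by simp) ?_
      simp; omega
    rw [Nat.card_eq_fintype_card, Fintype.card_subtype]
    refine le_trans (Finset.card_le_card ?_)
      ((Multiset.toFinset_card_le _).trans ((Polynomial.card_roots' _).trans hdeg))
    intro a ha
    have ha' : a ^ q + a = 0 := (Finset.mem_filter.1 ha).2
    simp [hne, ha']
  let fixed : Finset F := Finset.univ.filter fun z => z ^ q = z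
  have hfix : fixed.card ≤ q := by
    have hne : (Polynomial.X ^ q - Polynomial.X : Polynomial F) ≠ 0 :=
      FiniteField.X_pow_card_sub_X_ne_zero F hq2
    rw [← FiniteField.X_pow_card_sub_X_natDegree_eq F hq2]
    refine le_trans (Finset.card_le_card ?_)
      ((Multiset.toFinset_card_le _).trans (Polynomial.card_roots' _))
    intro a ha
    have ha' : a ^ q = a := by simpa [fixed] using ha
    simp [hne, ha']
  let img : Finset F := Finset.univ.image tr
  have himg : img ⊆ fixed := by
    intro z hz
    obtain ⟨y, -, rfl⟩ := Finset.mem_image.1 hz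
    simp only [fixed, Finset.mem_filter, Finset.mem_univ, true_and]
    change (y ^ q + y) ^ q = y ^ q + y
    rw [hfrob, hqq, add_comm]
  have hmul : img.card * Nat.card tr.ker = q ^ 2 := by
    have h1 := AddSubgroup.card_eq_card_quotient_mul_card_addSubgroup tr.ker
    rw [Nat.card_congr (QuotientAddGroup.quotientKerEquivRange tr).toEquiv,
      Nat.card_eq_fintype_card, hF] at h1
    rw [h1]
    congr 1
    rw [← Set.ncard_coe_finset, Finset.coe_image, Finset.coe_univ, Set.image_univ]
    rfl
  have hkerq : Nat.card tr.ker = q := by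
    have := Finset.card_le_card himg
    nlinarith
  have himgeq : img = fixed := by
    refine Finset.eq_of_subset_of_card_le himg (hfix.trans ?_)
    rw [hkerq] at hmul
    nlinarith
  have hfib : ∀ x : F, Nat.card tr.ker = Nat.card {y : F // y ^ q + y = x ^ (q + 1)} := by
    intro x
    have hx : x ^ (q + 1) ∈ img := by
      rw [himgeq]
      simp only [fixed, Finset.mem_filter, Finset.mem_univ, true_and]
      rw [← pow_mul, mul_comm, pow_mul, pow_succ, hqq, pow_succ, mul_comm]
    obtain ⟨y₀, -, hy₀⟩ := Finset.mem_image.1 hx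
    refine Nat.card_congr ((Equiv.addRight y₀).subtypeEquiv fun k => ?_)
    rw [← hy₀]
    change tr k = 0 ↔ tr (k + y₀) = tr y₀
    simp
  have hequiv : {xy : F × F // xy.2 ^ q + xy.2 = xy.1 ^ (q + 1)} ≃
      (Σ x : F, {y : F // y ^ q + y = x ^ (q + 1)}) :=
    { toFun := fun s => ⟨s.1.1, s.1.2, s.2⟩
      invFun := fun s => ⟨(s.1, s.2.1), s.2.2⟩
      left_inv := fun _ => rfl
      right_inv := fun _ => rfl }
  rw [Nat.card_congr hequiv, Nat.card_sigma]
  simp only [← hfib, hkerq, Finset.sum_const, Finset.card_univ, hF, smul_eq_mul]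
  exact le_of_eq (by ring)

/-- Every function on a set of points of the affine plane over a finite field is polynomial. -/
theorem span_monomial_eq_top {F : Type*} [Field F] [Fintype F] (P : F × F → Prop) :
    Submodule.span F {f : {xy : F × F // P xy} → F |
      ∃ i j : ℕ, f = (fun s => s.val.1) ^ i * (fun s => s.val.2) ^ j} = ⊤ := by
  classical
  set x : {xy : F × F // P xy} → F := fun s => s.val.1 with hx
  set y : {xy : F × F // P xy} → F := fun s => s.val.2 with hy
  have hset : {f | ∃ i j : ℕ, f = x ^ i * y ^ j} =
      (Submonoid.closure {x, y} : Set ({xy : F × F // P xy} → F)) := by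
    ext f
    simp only [Set.mem_ofPred_eq, SetLike.mem_coe, Submonoid.mem_closure_pair, eq_comm]
  rw [hset, ← Algebra.adjoin_eq_span, Algebra.toSubmodule_eq_top, eq_top_iff]
  intro f _
  have hxm : x ∈ Algebra.adjoin F {x, y} := Algebra.subset_adjoin (by simp)
  have hym : y ∈ Algebra.adjoin F {x, y} := Algebra.subset_adjoin (by simp)
  have hind : ∀ a b : F, (1 - (x - algebraMap F _ a) ^ (Fintype.card F - 1)) *
      (1 - (y - algebraMap F _ b) ^ (Fintype.card F - 1)) ∈ Algebra.adjoin F {x, y} := fun a b =>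
    mul_mem
      (sub_mem (one_mem _) (pow_mem (sub_mem hxm (Subalgebra.algebraMap_mem _ _)) _))
      (sub_mem (one_mem _) (pow_mem (sub_mem hym (Subalgebra.algebraMap_mem _ _)) _))
  have hpow : ∀ c : F, 1 - c ^ (Fintype.card F - 1) = if c = 0 then 1 else 0 := by
    intro c
    split_ifs with hc
    · have := Fintype.one_lt_card (α := F)
      rw [hc, zero_pow (by omega), sub_zero]
    · rw [FiniteField.pow_card_sub_one_eq_one c hc, sub_self]
  have hf : f = ∑ t : {xy : F × F // P xy}, f t •
      ((1 - (x - algebraMap F _ t.1.1) ^ (Fintype.card F - 1)) *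
        (1 - (y - algebraMap F _ t.1.2) ^ (Fintype.card F - 1))) := by
    ext s
    simp only [Finset.sum_apply, Pi.smul_apply, Pi.mul_apply, Pi.sub_apply, Pi.one_apply,
      Pi.pow_apply, Pi.algebraMap_apply, Algebra.algebraMap_self, RingHom.id_apply, hpow, smul_eq_mul]
    rw [Finset.sum_eq_single s]
    · simp [hx, hy]
    · intro t _ hts
      have : ¬ (s.1.1 - t.1.1 = 0 ∧ s.1.2 - t.1.2 = 0) := by
        rintro ⟨h1, h2⟩
        exact hts (Subtype.ext (Prod.ext (sub_eq_zero.1 h1).symm (sub_eq_zero.1 h2).symm))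
      simp only [hx, hy]
      rcases not_and_or.1 this with h | h <;> simp [h]
    · simp
  rw [hf]
  exact sum_mem fun t _ => Subalgebra.smul_mem _ (hind _ _) _

end Curve


/-- The one-point Hermitian code of length `n = q³` and parameter `m_H` with
`2(g−1) < m_H < q³` has dimension `k = m_H − g + 1`, where `g = q(q−1)/2`: the space of
functions on the affine points of the Hermitian curve spanned by the evaluations of the
monomials `X^i Y^j` with `j < q` and `q·i + (q+1)·j ≤ m_H` has dimension `m_H − g + 1`. -/
theorem hermitian_code_dimension (p e q : ℕ) (hp : p.Prime) (he : 1 ≤ e) (hq : q = p ^ e)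
    (F : Type*) [Field F] [Fintype F] (hF : Fintype.card F = q ^ 2)
    (mH : ℕ) (hmH1 : 2 * (q * (q - 1) / 2 - 1) < mH) (hmH2 : mH < q ^ 3) :
    Module.finrank F
        (Submodule.span F
          {f : {xy : F × F // xy.2 ^ q + xy.2 = xy.1 ^ (q + 1)} → F |
            ∃ i j : ℕ, j < q ∧ q * i + (q + 1) * j ≤ mH ∧
              f = fun s => s.val.1 ^ i * s.val.2 ^ j})
      = mH - q * (q - 1) / 2 + 1 := by
  classical
  have hq2 : 2 ≤ q := hq ▸ hp.two_le.trans (Nat.le_self_pow (by omega) p)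
  let x : {xy : F × F // xy.2 ^ q + xy.2 = xy.1 ^ (q + 1)} → F := fun s => s.val.1
  let y : {xy : F × F // xy.2 ^ q + xy.2 = xy.1 ^ (q + 1)} → F := fun s => s.val.2
  have hxy : y ^ q + y = x ^ (q + 1) := funext fun s => s.2
  have hlead : ∀ u ∈ hermitianExponents q mH,
      x ^ u.1 * y ^ u.2 ∉ hermitianLT F q x y (q * u.1 + (q + 1) * u.2) := by
    intro u hu hmem
    obtain ⟨B, hB, hspan⟩ := exists_finset_span_monomial hq2 hxy hmem
    have htop : Submodule.span F (SetLike.coe B) = ⊤ := by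
      rw [eq_top_iff, ← span_monomial_eq_top, Submodule.span_le]
      rintro _ ⟨i, j, rfl⟩
      exact hspan i j
    have h1 : Set.finrank F (SetLike.coe B) ≤ B.card := finrank_span_finset_le_card B
    rw [Set.finrank, htop, finrank_top, Module.finrank_fintype_fun_eq_card,
      ← Nat.card_eq_fintype_card] at h1
    have h2 := card_hermitianCurve_ge hp he hq F hF
    have h3 := (mem_hermitianExponents.1 hu).2
    omega
  have hli := linearIndependent_monomial (F := F)
    (fun u hu => (mem_hermitianExponents.1 hu).1) hlead
  have hrank := finrank_span_eq_card hli
  rw [Fintype.card_coe, card_hermitianExponents hq2 hmH1] at hrank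
  have hset : {f : {xy : F × F // xy.2 ^ q + xy.2 = xy.1 ^ (q + 1)} → F |
      ∃ i j : ℕ, j < q ∧ q * i + (q + 1) * j ≤ mH ∧ f = fun s => s.val.1 ^ i * s.val.2 ^ j} =
      Set.range fun u : hermitianExponents q mH => x ^ u.1.1 * y ^ u.1.2 := by
    ext f
    constructor
    · rintro ⟨i, j, hj, hd, rfl⟩
      exact ⟨⟨(i, j), mem_hermitianExponents.2 ⟨hj, hd⟩⟩, rfl⟩
    · rintro ⟨⟨⟨i, j⟩, hu⟩, rfl⟩
      obtain ⟨hj, hd⟩ := mem_hermitianExponents.1 hu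
      exact ⟨i, j, hj, hd, rfl⟩
  rw [hset, hrank]
end
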